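/- arXiv:2010.09710 — 2 statements merged into one kernel-verified Lean document; each statement's English description precedes it below -/
import Mathlib

section
/- Fixed points of the perturbed-iteration map (Lemma 5.3, with constants corrected so that the fixed-point equation is exact). Let ρ > 0, ε1 ∈ (0,1), ε2 ∈ [0,1), and define Φ(η) = (1/(1−ε2)) ( ρη/(1 − ε1(1+η)) + ε2 ) on the interval [0, 1/ε1 − 1). Set δ = ((1−ε2) − ρ − ε1(1 − 2ε2)) / (2 ε1 (1−ε2)) and σ = ε2(1−ε1) / (ε1(1−ε2)). Assume δ > 0, δ² > σ, and η+ := δ + √(δ²−σ) < 1/ε1 − 1. Then the two numbers η± = δ ± √(δ²−σ) satisfy 0 ≤ η− < η+, they are fixed points of Φ, and they are the only fixed points of Φ in [0, 1/ε1 − 1); moreover Φ(η) > η for all η ∈ [0, η−), Φ(η) < η for all η ∈ (η−, η+), and for every η ∈ [0, η+) the iterates Φ^k(η) are defined for all k ≥ 0 and converge monotonically to η− as k → ∞ (nondecreasing if η ≤ η−, nonincreasing if η ≥ η−). -/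
open Set Filter Topology

/-- If `f` is monotone and continuous on `[x, a]`, fixes `a` and lies strictly above the diagonal on
`[x, a)`, then the orbit of `x` increases to `a`. -/
theorem iterate_mem_Icc_and_monotone_and_tendsto {α : Type*} [ConditionallyCompleteLinearOrder α]
    [TopologicalSpace α] [OrderTopology α] {f : α → α} {x a : α} (hxa : x ≤ a) (ha : f a = a)
    (hmono : MonotoneOn f (Icc x a)) (hlt : ∀ y ∈ Ico x a, y < f y)
    (hcont : ∀ y ∈ Icc x a, ContinuousAt f y) :
    (∀ k, f^[k] x ∈ Icc x a) ∧ (Monotone fun k => f^[k] x) ∧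
      Tendsto (fun k => f^[k] x) atTop (𝓝 a) := by
  have hle : ∀ y ∈ Icc x a, y ≤ f y := fun y hy =>
    hy.2.eq_or_lt.elim (fun h => by rw [h, ha]) fun h => (hlt y ⟨hy.1, h⟩).le
  have hmaps : MapsTo f (Icc x a) (Icc x a) := fun y hy =>
    ⟨hy.1.trans (hle y hy), (hmono hy ⟨hxa, le_rfl⟩ hy.2).trans_eq ha⟩
  have hmem : ∀ k, f^[k] x ∈ Icc x a := fun k => hmaps.iterate k ⟨le_rfl, hxa⟩
  have hm : Monotone fun k => f^[k] x := monotone_nat_of_le_succ fun k => by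
    rw [Function.iterate_succ_apply']
    exact hle _ (hmem k)
  have hlim := tendsto_atTop_ciSup hm ⟨a, by rintro _ ⟨k, rfl⟩; exact (hmem k).2⟩
  have hL := isClosed_Icc.mem_of_tendsto hlim (Eventually.of_forall hmem)
  have hfix := isFixedPt_of_tendsto_iterate hlim (hcont _ hL)
  refine ⟨hmem, hm, ?_⟩
  rcases hL.2.lt_or_eq with h | h
  · exact absurd hfix (hlt _ ⟨hL.1, h⟩).ne'
  · rwa [h] at hlim

/-- If `f` is monotone and continuous on `[a, x]`, fixes `a` and lies strictly below the diagonal on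
`(a, x]`, then the orbit of `x` decreases to `a`. -/
theorem iterate_mem_Icc_and_antitone_and_tendsto {α : Type*} [ConditionallyCompleteLinearOrder α]
    [TopologicalSpace α] [OrderTopology α] {f : α → α} {x a : α} (hax : a ≤ x) (ha : f a = a)
    (hmono : MonotoneOn f (Icc a x)) (hlt : ∀ y ∈ Ioc a x, f y < y)
    (hcont : ∀ y ∈ Icc a x, ContinuousAt f y) :
    (∀ k, f^[k] x ∈ Icc a x) ∧ (Antitone fun k => f^[k] x) ∧
      Tendsto (fun k => f^[k] x) atTop (𝓝 a) := by
  obtain ⟨h1, h2, h3⟩ := iterate_mem_Icc_and_monotone_and_tendsto (α := αᵒᵈ) (f := f) (x := x)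
    (a := a) hax ha (fun y hy z hz h => hmono ⟨hz.2, hz.1⟩ ⟨hy.2, hy.1⟩ h)
    (fun y hy => hlt y ⟨hy.2, hy.1⟩) (fun y hy => hcont y ⟨hy.2, hy.1⟩)
  exact ⟨fun k => ⟨(h1 k).2, (h1 k).1⟩, fun i j h => h2 h, h3⟩


/-- **Fixed points of the perturbed-iteration map** (Lemma 5.3, with constants
corrected so that the fixed-point equation is exact).  The map
`Φ(η) = (ρη/(1 − ε₁(1+η)) + ε₂)/(1 − ε₂)` on `[0, 1/ε₁ − 1)` has exactly the two
fixed points `η± = δ ± √(δ² − σ)`; `Φ(η) > η` below `η₋`, `Φ(η) < η` between the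
fixed points, and every orbit started in `[0, η₊)` stays in the domain and
converges monotonically to `η₋`. -/
theorem fixed_points_perturbed_map
    (ρ ε1 ε2 : ℝ) (hρ : 0 < ρ)
    (hε1 : ε1 ∈ Set.Ioo (0 : ℝ) 1) (hε2 : ε2 ∈ Set.Ico (0 : ℝ) 1)
    (Φ : ℝ → ℝ)
    (hΦ : ∀ η, Φ η = (1 / (1 - ε2)) * (ρ * η / (1 - ε1 * (1 + η)) + ε2))
    (δ σ : ℝ)
    (hδdef : δ = ((1 - ε2) - ρ - ε1 * (1 - 2 * ε2)) / (2 * ε1 * (1 - ε2)))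
    (hσdef : σ = ε2 * (1 - ε1) / (ε1 * (1 - ε2)))
    (hδ : 0 < δ) (hδσ : σ < δ ^ 2)
    (ηm ηp : ℝ)
    (hηm : ηm = δ - Real.sqrt (δ ^ 2 - σ))
    (hηp : ηp = δ + Real.sqrt (δ ^ 2 - σ))
    (hdom : ηp < 1 / ε1 - 1) :
    (0 ≤ ηm ∧ ηm < ηp) ∧
    Φ ηm = ηm ∧ Φ ηp = ηp ∧
    (∀ η ∈ Set.Ico (0 : ℝ) (1 / ε1 - 1), Φ η = η → η = ηm ∨ η = ηp) ∧
    (∀ η ∈ Set.Ico (0 : ℝ) ηm, η < Φ η) ∧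
    (∀ η ∈ Set.Ioo ηm ηp, Φ η < η) ∧
    (∀ η ∈ Set.Ico (0 : ℝ) ηp,
      (∀ k : ℕ, Φ^[k] η ∈ Set.Ico (0 : ℝ) (1 / ε1 - 1)) ∧
      Filter.Tendsto (fun k => Φ^[k] η) Filter.atTop (nhds ηm) ∧
      (η ≤ ηm → Monotone fun k => Φ^[k] η) ∧
      (ηm ≤ η → Antitone fun k => Φ^[k] η)) := by
  obtain ⟨h10, h11⟩ := hε1
  obtain ⟨h20, h21⟩ := hε2
  have he : 0 < 1 - ε2 := by linarith
  have hs : 0 < Real.sqrt (δ ^ 2 - σ) := Real.sqrt_pos.2 (by linarith)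
  have hss : Real.sqrt (δ ^ 2 - σ) ^ 2 = δ ^ 2 - σ := Real.sq_sqrt (by linarith)
  have hσ : 0 ≤ σ := by
    rw [hσdef]
    exact div_nonneg (mul_nonneg h20 (by linarith)) (by positivity)
  have hm0 : 0 ≤ ηm := by
    rw [hηm, sub_nonneg]
    exact Real.sqrt_le_iff.2 ⟨hδ.le, by linarith⟩
  have hmp : ηm < ηp := by linarith
  have hsum : ηm + ηp = 2 * δ := by rw [hηm, hηp]; ring
  have hprod : ηm * ηp = σ := by rw [hηm, hηp]; linear_combination -hss
  have hden : ∀ η, η < 1 / ε1 - 1 → 0 < 1 - ε1 * (1 + η) := fun η h => by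
    have h' : 1 + η < 1 / ε1 := by linarith
    rw [lt_div_iff₀ h10] at h'
    linarith
  have hdiff : ∀ η, η < 1 / ε1 - 1 →
      Φ η - η = ε1 * ((η - ηm) * (η - ηp)) / (1 - ε1 * (1 + η)) := fun η h => by
    have hD := (hden η h).ne'
    have hquad : (η - ηm) * (η - ηp) = η ^ 2 - 2 * δ * η + σ := by
      linear_combination (-η) * hsum + hprod
    have hδ' : 2 * ε1 * (1 - ε2) * δ = (1 - ε2) - ρ - ε1 * (1 - 2 * ε2) := by
      rw [hδdef]; field_simp
    have hσ' : ε1 * (1 - ε2) * σ = ε2 * (1 - ε1) := by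
      rw [hσdef]; field_simp
    have hΦD : (1 - ε2) * Φ η * (1 - ε1 * (1 + η)) = ρ * η + ε2 * (1 - ε1 * (1 + η)) := by
      rw [hΦ]; field_simp
    rw [hquad, eq_div_iff hD]
    apply mul_left_cancel₀ he.ne'
    linear_combination hΦD + η * hδ' - hσ'
  have hmdom : ηm < 1 / ε1 - 1 := hmp.trans hdom
  have hfm : Φ ηm = ηm := sub_eq_zero.1 (by rw [hdiff _ hmdom]; simp)
  have hfp : Φ ηp = ηp := sub_eq_zero.1 (by rw [hdiff _ hdom]; simp)
  have hup : ∀ η ∈ Ico (0 : ℝ) ηm, η < Φ η := fun η h => by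
    rw [← sub_pos, hdiff η (h.2.trans hmdom)]
    exact div_pos (mul_pos h10 (mul_pos_of_neg_of_neg (by linarith [h.2]) (by linarith [h.2])))
      (hden η (h.2.trans hmdom))
  have hdown : ∀ η ∈ Ioo ηm ηp, Φ η < η := fun η h => by
    rw [← sub_neg, hdiff η (h.2.trans hdom)]
    exact div_neg_of_neg_of_pos (mul_neg_of_pos_of_neg h10
      (mul_neg_of_pos_of_neg (by linarith [h.1]) (by linarith [h.2]))) (hden η (h.2.trans hdom))
  have hmono : MonotoneOn Φ (Ico 0 (1 / ε1 - 1)) := fun x hx y hy hxy => by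
    have hDy := hden y hy.2
    rw [hΦ, hΦ]
    have hy0 := hy.1
    gcongr
  have hcont : ∀ y ∈ Ico 0 (1 / ε1 - 1), ContinuousAt Φ y := fun y hy => by
    have hD := (hden y hy.2).ne'
    rw [funext hΦ]
    fun_prop (disch := assumption)
  refine ⟨⟨hm0, hmp⟩, hfm, hfp, fun η h hη => ?_, hup, hdown, fun η h => ?_⟩
  · have h0 := hdiff η h.2
    rw [hη, sub_self, eq_comm, div_eq_zero_iff] at h0
    simpa [h10.ne', (hden η h.2).ne', sub_eq_zero] using h0
  · rcases le_total η ηm with hle | hle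
    · have hsub : Icc η ηm ⊆ Ico 0 (1 / ε1 - 1) := fun y hy =>
        ⟨h.1.trans hy.1, hy.2.trans_lt hmdom⟩
      obtain ⟨hmem, hmon, hlim⟩ := iterate_mem_Icc_and_monotone_and_tendsto hle hfm
        (hmono.mono hsub) (fun y hy => hup y ⟨h.1.trans hy.1, hy.2⟩)
        (fun y hy => hcont y (hsub hy))
      refine ⟨fun k => hsub (hmem k), hlim, fun _ => hmon, fun hge => ?_⟩
      obtain rfl := le_antisymm hle hge
      simpa only [Function.iterate_fixed hfm] using antitone_const
    · have hsub : Icc ηm η ⊆ Ico 0 (1 / ε1 - 1) := fun y hy =>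
        ⟨hm0.trans hy.1, (hy.2.trans_lt h.2).trans hdom⟩
      obtain ⟨hmem, hanti, hlim⟩ := iterate_mem_Icc_and_antitone_and_tendsto hle hfm
        (hmono.mono hsub) (fun y hy => hdown y ⟨hy.1, hy.2.trans_lt h.2⟩)
        (fun y hy => hcont y (hsub hy))
      refine ⟨fun k => hsub (hmem k), hlim, fun hge => ?_, fun _ => hanti⟩
      obtain rfl := le_antisymm hle hge
      simpa only [Function.iterate_fixed hfm] using monotone_const
end

section
/- Geometric convergence of the worst-case perturbed iteration (Theorem 5.4, under the corrected hypotheses of the fixed-point lemma). Let ρ > 0, ε1 ∈ (0,1), ε2 ∈ [0,1), and define Φ(η) = (1/(1−ε2)) ( ρη/(1 − ε1(1+η)) + ε2 ) on [0, 1/ε1 − 1), with δ = ((1−ε2) − ρ − ε1(1 − 2ε2)) / (2 ε1 (1−ε2)), σ = ε2(1−ε1)/(ε1(1−ε2)), and assume δ > 0, δ² > σ, and η+ := δ + √(δ²−σ) < 1/ε1 − 1; set η− = δ − √(δ²−σ). Let η0 satisfy η− ≤ η0 < η+, and define ρ̃ = ρ / ((1−ε2)(1 − ε1(1+η0))) and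 ε̃2 = ε2/(1−ε2). Then ρ̃ < 1 and, for every k ≥ 1, the k-fold iterate φk(η0) = Φ^k(η0) is defined and satisfies φk(η0) ≤ ρ̃^k η0 + ε̃2 (1 − ρ̃)^{-1}. -/
/-- If `f` maps `[0, x₀]` to nonnegative reals and is dominated there by the affine map
`x ↦ r x + e`, where `r x₀ + e ≤ x₀`, then the iterates of `f` at `x₀` stay in `[0, x₀]` and
converge geometrically up to the fixed point `e (1 - r)⁻¹` of the affine map. -/
lemma iterate_mem_Icc_and_le_of_le_affine {f : ℝ → ℝ} {x₀ r e : ℝ} (hx₀ : 0 ≤ x₀)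
    (hr : 0 ≤ r) (hr1 : r < 1) (he : 0 ≤ e) (hf₀ : ∀ x ∈ Set.Icc 0 x₀, 0 ≤ f x)
    (hf : ∀ x ∈ Set.Icc 0 x₀, f x ≤ r * x + e) (hfix : r * x₀ + e ≤ x₀) (k : ℕ) :
    f^[k] x₀ ∈ Set.Icc 0 x₀ ∧ f^[k] x₀ ≤ r ^ k * x₀ + e * (1 - r)⁻¹ := by
  have hr' : 0 < 1 - r := sub_pos.2 hr1
  induction k with
  | zero =>
    have : 0 ≤ e * (1 - r)⁻¹ := by positivity
    simpa [hx₀] using this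
  | succ k ih =>
    obtain ⟨hmem, hle⟩ := ih
    rw [Function.iterate_succ_apply']
    have hstep := hf _ hmem
    refine ⟨⟨hf₀ _ hmem, ?_⟩, ?_⟩
    · have := mul_le_mul_of_nonneg_left hmem.2 hr
      linarith
    · have hsum : r * (r ^ k * x₀ + e * (1 - r)⁻¹) + e = r ^ (k + 1) * x₀ + e * (1 - r)⁻¹ := by
        field_simp
        ring
      have := mul_le_mul_of_nonneg_left hle hr
      linarith

/-- **Geometric convergence of the worst-case perturbed iteration** (Theorem 5.4,
under the corrected hypotheses of the fixed-point lemma).  For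
`Φ(η) = (ρη/(1 − ε₁(1+η)) + ε₂)/(1 − ε₂)` and `η₋ ≤ η₀ < η₊`, with
`ρ̃ = ρ/((1−ε₂)(1−ε₁(1+η₀)))` and `ε̃₂ = ε₂/(1−ε₂)`, one has `ρ̃ < 1` and
`Φ^[k](η₀) ≤ ρ̃^k η₀ + ε̃₂ (1 − ρ̃)⁻¹` for every `k ≥ 1`, all iterates remaining
in the domain. -/
theorem geometric_convergence_perturbed_iteration
    (ρ ε1 ε2 : ℝ) (hρ : 0 < ρ)
    (hε1 : ε1 ∈ Set.Ioo (0 : ℝ) 1) (hε2 : ε2 ∈ Set.Ico (0 : ℝ) 1)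
    (Φ : ℝ → ℝ)
    (hΦ : ∀ η, Φ η = (1 / (1 - ε2)) * (ρ * η / (1 - ε1 * (1 + η)) + ε2))
    (δ σ : ℝ)
    (hδdef : δ = ((1 - ε2) - ρ - ε1 * (1 - 2 * ε2)) / (2 * ε1 * (1 - ε2)))
    (hσdef : σ = ε2 * (1 - ε1) / (ε1 * (1 - ε2)))
    (hδ : 0 < δ) (hδσ : σ < δ ^ 2)
    (ηm ηp : ℝ)
    (hηm : ηm = δ - Real.sqrt (δ ^ 2 - σ))
    (hηp : ηp = δ + Real.sqrt (δ ^ 2 - σ))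
    (hdom : ηp < 1 / ε1 - 1)
    (η0 : ℝ) (hη0l : ηm ≤ η0) (hη0u : η0 < ηp)
    (ρt εt : ℝ)
    (hρt : ρt = ρ / ((1 - ε2) * (1 - ε1 * (1 + η0))))
    (hεt : εt = ε2 / (1 - ε2)) :
    ρt < 1 ∧
    ∀ k : ℕ, 1 ≤ k →
      Φ^[k] η0 ∈ Set.Ico (0 : ℝ) (1 / ε1 - 1) ∧
      Φ^[k] η0 ≤ ρt ^ k * η0 + εt * (1 - ρt)⁻¹ := by
  obtain ⟨h1, h1'⟩ := hε1
  obtain ⟨h2, h2'⟩ := hε2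
  have h2p : 0 < 1 - ε2 := sub_pos.2 h2'
  have hsqrt : Real.sqrt (δ ^ 2 - σ) ^ 2 = δ ^ 2 - σ := Real.sq_sqrt (by linarith)
  have hσ : 0 ≤ σ := by
    have : 0 < 1 - ε1 := sub_pos.2 h1'
    rw [hσdef]
    positivity
  have hηm0 : 0 ≤ ηm := by
    have : Real.sqrt (δ ^ 2 - σ) ≤ δ := Real.sqrt_le_iff.2 ⟨hδ.le, by linarith⟩
    linarith
  have hη0 : 0 ≤ η0 := hηm0.trans hη0l
  have hηp0 : 0 < ηp := hη0.trans_lt hη0u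
  have hδmul : 2 * ε1 * (1 - ε2) * δ = (1 - ε2) - ρ - ε1 * (1 - 2 * ε2) := by
    rw [hδdef]
    field_simp
  have hσmul : ε1 * (1 - ε2) * σ = ε2 * (1 - ε1) := by
    rw [hσdef]
    field_simp
  -- the fixed-point equation with denominators cleared is a quadratic with roots `ηm` and `ηp`
  have hquad : ∀ η, ρ * η + ε2 * (1 - ε1 * (1 + η)) - η * ((1 - ε2) * (1 - ε1 * (1 + η)))
      = ε1 * (1 - ε2) * ((η - ηm) * (η - ηp)) := by
    intro η
    rw [hηm, hηp]
    linear_combination η * hδmul - hσmul + ε1 * (1 - ε2) * hsqrt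
  have hDp : 0 < 1 - ε1 * (1 + ηp) := by
    have := mul_lt_mul_of_pos_left hdom h1
    have h : ε1 * (1 / ε1 - 1) = 1 - ε1 := by field_simp
    linarith
  have hD : 1 - ε1 * (1 + ηp) < 1 - ε1 * (1 + η0) := by
    have := mul_lt_mul_of_pos_left hη0u h1
    linarith
  have hD0 : 0 < 1 - ε1 * (1 + η0) := hDp.trans hD
  have hρp : ρ ≤ (1 - ε2) * (1 - ε1 * (1 + ηp)) := by
    have h := hquad ηp
    have : 0 ≤ ε2 * (1 - ε1 * (1 + ηp)) := mul_nonneg h2 hDp.le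
    refine le_of_mul_le_mul_left ?_ hηp0
    linarith
  have hρt1 : ρt < 1 := by
    rw [hρt, div_lt_one (mul_pos h2p hD0)]
    exact hρp.trans_lt (mul_lt_mul_of_pos_left hD h2p)
  have hρt0 : 0 ≤ ρt := by
    rw [hρt]
    positivity
  have hεt0 : 0 ≤ εt := by
    rw [hεt]
    positivity
  have hfix : ρt * η0 + εt ≤ η0 := by
    have hle : ε1 * (1 - ε2) * ((η0 - ηm) * (η0 - ηp)) ≤ 0 :=
      mul_nonpos_of_nonneg_of_nonpos (by positivity)
        (mul_nonpos_of_nonneg_of_nonpos (sub_nonneg.2 hη0l) (sub_nonpos.2 hη0u.le))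
    have h : ρt * η0 + εt = (ρ * η0 + ε2 * (1 - ε1 * (1 + η0)))
        / ((1 - ε2) * (1 - ε1 * (1 + η0))) := by
      rw [hρt, hεt]
      field_simp
    rw [h, div_le_iff₀ (mul_pos h2p hD0)]
    linarith [hquad η0]
  have hden : ∀ x ∈ Set.Icc 0 η0, 1 - ε1 * (1 + η0) ≤ 1 - ε1 * (1 + x) := by
    intro x hx
    have := mul_le_mul_of_nonneg_left hx.2 h1.le
    linarith
  have hΦ0 : ∀ x ∈ Set.Icc 0 η0, 0 ≤ Φ x := by
    intro x hx
    have hDx := hD0.trans_le (hden x hx)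
    have hx0 := hx.1
    rw [hΦ]
    positivity
  have hΦle : ∀ x ∈ Set.Icc 0 η0, Φ x ≤ ρt * x + εt := by
    intro x hx
    have h : ρt * x + εt = (1 / (1 - ε2)) * (ρ * x / (1 - ε1 * (1 + η0)) + ε2) := by
      rw [hρt, hεt]
      field_simp
    rw [h, hΦ]
    have hx0 := hx.1
    have := hden x hx
    gcongr
  refine ⟨hρt1, fun k _ => ?_⟩
  obtain ⟨hmem, hle⟩ :=
    iterate_mem_Icc_and_le_of_le_affine hη0 hρt0 hρt1 hεt0 hΦ0 hΦle hfix k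
  exact ⟨⟨hmem.1, hmem.2.trans_lt (hη0u.trans hdom)⟩, hle⟩
end
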